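/- Let Γ and G be countable discrete groups. If Γ randomly embeds in G and G is amenable, then Γ is amenable. -/

import Mathlib

open MeasureTheory

/-- A discrete group `G` is amenable: there exists a left-invariant mean on the
bounded real-valued functions on `G`. -/
def IsAmenable (G : Type*) [Group G] : Prop :=
  ∃ m : (G → ℝ) → ℝ,
    (∀ f₁ f₂ : G → ℝ, (∃ C, ∀ x, |f₁ x| ≤ C) → (∃ C, ∀ x, |f₂ x| ≤ C) →
      m (f₁ + f₂) = m f₁ + m f₂) ∧
    (∀ (c : ℝ) (f : G → ℝ), (∃ C, ∀ x, |f x| ≤ C) → m (c • f) = c * m f) ∧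
    (∀ f : G → ℝ, (∃ C, ∀ x, |f x| ≤ C) → (∀ x, 0 ≤ f x) → 0 ≤ m f) ∧
    m 1 = 1 ∧
    (∀ (g : G) (f : G → ℝ), (∃ C, ∀ x, |f x| ≤ C) → m (fun t => f (g⁻¹ * t)) = m f)

/-- `[Γ,G]`: the set of injective maps `h : Γ → G` with `h 1 = 1`, as a subset of the
product space `G^Γ`. -/
def embSet (Γ G : Type*) [Group Γ] [Group G] : Set (Γ → G) :=
  {h | Function.Injective h ∧ h 1 = 1}

/-- The action of `Γ` on maps `h : Γ → G`: `(γ·h)(t) = h(tγ) h(γ)⁻¹`. -/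
def gammaAct {Γ G : Type*} [Group Γ] [Group G] (γ : Γ) (h : Γ → G) : Γ → G :=
  fun t => h (t * γ) * (h γ)⁻¹

/-- `Γ` randomly embeds in `G`: there is a `Γ`-invariant probability measure on
`[Γ,G]`. -/
def RandomlyEmbeds (Γ G : Type*) [Group Γ] [Group G]
    [MeasurableSpace G] [DiscreteMeasurableSpace G] : Prop :=
  ∃ P : Measure (Γ → G), IsProbabilityMeasure P ∧ P (embSet Γ G)ᶜ = 0 ∧
    ∀ γ : Γ, Measure.map (gammaAct γ) P = P

open Filter Topology Function

/-- A mean on the bounded real-valued functions on `X`. -/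
structure IsMean {X : Type*} (m : (X → ℝ) → ℝ) : Prop where
  add : ∀ f₁ f₂ : X → ℝ, (∃ C, ∀ x, |f₁ x| ≤ C) → (∃ C, ∀ x, |f₂ x| ≤ C) →
    m (f₁ + f₂) = m f₁ + m f₂
  smul : ∀ (c : ℝ) (f : X → ℝ), (∃ C, ∀ x, |f x| ≤ C) → m (c • f) = c * m f
  nonneg : ∀ f : X → ℝ, (∃ C, ∀ x, |f x| ≤ C) → (∀ x, 0 ≤ f x) → 0 ≤ m f
  one : m 1 = 1

namespace IsMean

variable {X : Type*} {m : (X → ℝ) → ℝ}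

lemma sub (hm : IsMean m) {f₁ f₂ : X → ℝ} (h₁ : ∃ C, ∀ x, |f₁ x| ≤ C)
    (h₂ : ∃ C, ∀ x, |f₂ x| ≤ C) : m (f₁ - f₂) = m f₁ - m f₂ := by
  obtain ⟨C, hC⟩ := h₂
  have h := hm.add f₁ ((-1 : ℝ) • f₂) h₁ ⟨C, fun x => by simpa using hC x⟩
  rw [hm.smul _ _ ⟨C, hC⟩] at h
  rw [sub_eq_add_neg, ← neg_one_smul ℝ f₂, h]
  ring

lemma le_of_abs_le (hm : IsMean m) {f : X → ℝ} {C : ℝ} (hC : ∀ x, |f x| ≤ C) : m f ≤ C := by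
  have hb : ∃ D, ∀ x, |(C • (1 : X → ℝ)) x| ≤ D := ⟨|C|, fun x => by simp⟩
  have hs := hm.sub hb ⟨C, hC⟩
  have h0 : 0 ≤ m (C • (1 : X → ℝ) - f) := by
    refine hm.nonneg _ ⟨|C| + C, fun x => ?_⟩ fun x => ?_
    · refine (abs_sub _ _).trans (add_le_add ?_ (hC x))
      simp
    · simpa using (le_abs_self _).trans (hC x)
  rw [hs, hm.smul _ _ ⟨1, fun x => by simp⟩, hm.one] at h0
  linarith

lemma abs_le (hm : IsMean m) {f : X → ℝ} {C : ℝ} (hC : ∀ x, |f x| ≤ C) : |m f| ≤ C := by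
  refine abs_le'.2 ⟨hm.le_of_abs_le hC, ?_⟩
  have h := hm.le_of_abs_le (f := (-1 : ℝ) • f) (C := C) fun x => by simpa using hC x
  rw [hm.smul _ _ ⟨C, hC⟩] at h
  linarith

lemma sum (hm : IsMean m) {ι : Type*} (s : Finset ι) {f : ι → X → ℝ} {C : ℝ}
    (hC : ∀ i x, |f i x| ≤ C) : m (∑ i ∈ s, f i) = ∑ i ∈ s, m (f i) := by
  classical
  induction s using Finset.induction_on with
  | empty => simpa using hm.smul 0 0 ⟨0, by simp⟩
  | insert i s hi ih =>
    rw [Finset.sum_insert hi, Finset.sum_insert hi, ← ih]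
    refine hm.add _ _ ⟨C, hC i⟩ ⟨∑ j ∈ s, C, fun x => ?_⟩
    rw [Finset.sum_apply]
    exact (Finset.abs_sum_le_sum_abs _ _).trans (Finset.sum_le_sum fun j _ => hC j x)

end IsMean

lemma tendsto_measureReal_preimage_finset_compl {Ω G : Type*} [MeasurableSpace Ω] [Countable G]
    [MeasurableSpace G] [DiscreteMeasurableSpace G] (P : Measure Ω) [IsFiniteMeasure P]
    {a : Ω → G} (ha : Measurable a) :
    Tendsto (fun s : Finset G => P.real (a ⁻¹' (s : Set G))ᶜ) atTop (𝓝 0) := by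
  have hsum (t : Set G) : ∑' b : t, P (a ⁻¹' {(b : G)}) = P (a ⁻¹' t) :=
    tsum_measure_preimage_singleton t.to_countable fun y _ => ha (measurableSet_singleton y)
  have hfin : ∑' b, P (a ⁻¹' {b}) ≠ ⊤ := by
    rw [← tsum_univ, hsum]
    exact measure_ne_top _ _
  have h := ENNReal.tendsto_tsum_compl_atTop_zero hfin
  refine (ENNReal.toReal_zero ▸ (ENNReal.tendsto_toReal ENNReal.zero_ne_top).comp h).congr
    fun s => ?_
  rw [Function.comp_apply, measureReal_def, ← Set.preimage_compl]
  exact congrArg ENNReal.toReal (hsum (s : Set G)ᶜ)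

section Integral

variable {Ω X G : Type*} [MeasurableSpace Ω] [Countable G] [MeasurableSpace G]
  [DiscreteMeasurableSpace G] {P : Measure Ω} [IsProbabilityMeasure P]

lemma abs_setIntegral_le_of_abs_le {f : Ω → ℝ} {C : ℝ} (hC : ∀ ω, |f ω| ≤ C) (s : Set Ω) :
    |∫ ω in s, f ω ∂P| ≤ C * P.real s :=
  norm_setIntegral_le_of_norm_le_const (f := f) (measure_lt_top P s) fun ω _ => hC ω

lemma abs_setIntegral_le_bound {f : Ω → ℝ} {C : ℝ} (hC : ∀ ω, |f ω| ≤ C) (s : Set Ω) :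
    |∫ ω in s, f ω ∂P| ≤ C := by
  obtain ⟨ω⟩ := nonempty_of_isProbabilityMeasure P
  exact (abs_setIntegral_le_of_abs_le hC s).trans
    (mul_le_of_le_one_right ((abs_nonneg _).trans (hC ω)) measureReal_le_one)

lemma abs_integral_le_bound {f : Ω → ℝ} {C : ℝ} (hC : ∀ ω, |f ω| ≤ C) :
    |∫ ω, f ω ∂P| ≤ C := by
  simpa using abs_setIntegral_le_bound (P := P) hC Set.univ

lemma integrable_of_abs_le {f : Ω → ℝ} (hf : Measurable f) {C : ℝ} (hC : ∀ ω, |f ω| ≤ C) :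
    Integrable f P :=
  Integrable.of_bound hf.aestronglyMeasurable C (ae_of_all _ hC)

/-- A mean commutes with the decomposition of an integral along the fibres of a
countably-valued map. -/
lemma IsMean.hasSum_setIntegral {m : (X → ℝ) → ℝ} (hm : IsMean m) {a : Ω → G}
    (ha : Measurable a) {F : Ω → X → ℝ} (hF : ∀ x, Measurable fun ω => F ω x) {C : ℝ}
    (hC : ∀ ω x, |F ω x| ≤ C) :
    HasSum (fun k => m fun x => ∫ ω in a ⁻¹' {k}, F ω x ∂P) (m fun x => ∫ ω, F ω x ∂P) := by
  have hlim := (tendsto_measureReal_preimage_finset_compl P ha).const_mul C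
  rw [mul_zero] at hlim
  rw [HasSum, SummationFilter.unconditional_filter, tendsto_iff_dist_tendsto_zero]
  refine squeeze_zero (fun _ => dist_nonneg) (fun s => ?_) hlim
  have hbs : ∀ k x, |∫ ω in a ⁻¹' {k}, F ω x ∂P| ≤ C := fun k x =>
    abs_setIntegral_le_bound (fun ω => hC ω x) _
  have hsum : (∑ k ∈ s, fun x => ∫ ω in a ⁻¹' {k}, F ω x ∂P) =
      fun x => ∫ ω in a ⁻¹' (s : Set G), F ω x ∂P := by
    funext x
    rw [Finset.sum_apply, ← integral_biUnion_finset s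
      (fun k _ => ha (measurableSet_singleton k))
      (fun i _ j _ hij => (Set.disjoint_singleton.2 hij).preimage a)
      (fun k _ => (integrable_of_abs_le (hF x) fun ω => hC ω x).integrableOn)]
    congr 2
    ext ω
    simp
  rw [← hm.sum s hbs, hsum, dist_comm, Real.dist_eq,
    ← hm.sub ⟨C, fun x => abs_integral_le_bound fun ω => hC ω x⟩
      ⟨C, fun x => abs_setIntegral_le_bound (fun ω => hC ω x) _⟩]
  refine hm.abs_le fun x => ?_
  have h := integral_add_compl (ha (.of_discrete (s := (s : Set G))))
    (integrable_of_abs_le (P := P) (hF x) fun ω => hC ω x)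
  rw [Pi.sub_apply, ← h, add_sub_cancel_left]
  exact abs_setIntegral_le_of_abs_le (fun ω => hC ω x) _

/-- A left-invariant mean, averaged over a probability space, is invariant under random
left translations. -/
lemma IsMean.integral_random_translate [Group G] {m : (G → ℝ) → ℝ} (hm : IsMean m)
    (hinv : ∀ (g : G) (f : G → ℝ), (∃ C, ∀ x, |f x| ≤ C) → m (fun t => f (g⁻¹ * t)) = m f)
    {a : Ω → G} (ha : Measurable a) {F : Ω → G → ℝ} (hF : ∀ g, Measurable fun ω => F ω g) {C : ℝ}
    (hC : ∀ ω g, |F ω g| ≤ C) :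
    (m fun g => ∫ ω, F ω (a ω * g) ∂P) = m fun g => ∫ ω, F ω g ∂P := by
  have hF' : Measurable (uncurry F) := measurable_from_prod_countable_left hF
  have h₁ := hm.hasSum_setIntegral (P := P) ha (F := fun ω g => F ω (a ω * g))
    (fun g => hF'.comp (measurable_id.prodMk
      ((Measurable.of_discrete (f := fun k : G => k * g)).comp ha))) (fun ω g => hC ω _)
  refine h₁.unique ?_
  convert hm.hasSum_setIntegral (P := P) ha hF hC using 2 with k
  rw [← hinv k⁻¹ _ ⟨C, fun g => abs_setIntegral_le_bound (fun ω => hC ω g) _⟩]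
  congr 1
  funext g
  refine setIntegral_congr_fun (ha (measurableSet_singleton k)) fun ω hω => ?_
  have hω' : a ω = k := hω
  simp only [hω', inv_inv]

end Integral

section ArgMin

variable {Γ G : Type*} [Group Γ] [Group G] [Countable Γ] [Countable G]

/-- The weight of `γ` at `(h, g)`: the index of `h γ * g` in an enumeration of `G`, with
ties broken by an enumeration of `Γ`. -/
noncomputable def orbitWeight (h : Γ → G) (g : G) (γ : Γ) : ℕ ×ₗ ℕ :=
  toLex ((nonempty_embedding_nat G).some (h γ * g), (nonempty_embedding_nat Γ).some γ)

/-- The element `γ` whose weight at `(h, g)` is minimal. -/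
noncomputable def orbitArgmin (h : Γ → G) (g : G) : Γ :=
  argmin (orbitWeight h g)

lemma orbitArgmin_eq_iff {h : Γ → G} {g : G} {γ : Γ} :
    orbitArgmin h g = γ ↔ ∀ γ', orbitWeight h g γ ≤ orbitWeight h g γ' := by
  refine ⟨fun e γ' => e ▸ argmin_le _ γ', fun H => ?_⟩
  have := le_antisymm (argmin_le (orbitWeight h g) γ) (H _)
  exact (nonempty_embedding_nat Γ).some.injective (congrArg (fun p => (ofLex p).2) this)

lemma orbitArgmin_eq_of_injective {h : Γ → G} (hh : Injective h) {g : G} {γ : Γ}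
    (H : ∀ γ', (nonempty_embedding_nat G).some (h γ * g) ≤
      (nonempty_embedding_nat G).some (h γ' * g)) : orbitArgmin h g = γ := by
  refine orbitArgmin_eq_iff.2 fun γ' => ?_
  rcases (H γ').lt_or_eq with hlt | heq
  · exact Prod.Lex.le_iff.2 (Or.inl hlt)
  · rw [hh (mul_right_cancel ((nonempty_embedding_nat G).some.injective heq))]

lemma orbitArgmin_minimal (h : Γ → G) (g : G) (γ' : Γ) :
    (nonempty_embedding_nat G).some (h (orbitArgmin h g) * g) ≤
      (nonempty_embedding_nat G).some (h γ' * g) := by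
  rcases Prod.Lex.le_iff.1 (orbitArgmin_eq_iff.1 (Eq.refl (orbitArgmin h g)) γ') with hlt | heq
  · exact hlt.le
  · exact heq.1.le

lemma orbitArgmin_gammaAct {h : Γ → G} (hh : Injective h) (g : G) (γ : Γ) :
    orbitArgmin (gammaAct γ h) (h γ * g) = orbitArgmin h g * γ⁻¹ := by
  refine orbitArgmin_eq_of_injective (fun s t hst => ?_) fun γ' => ?_
  · exact mul_right_cancel (hh (mul_right_cancel hst))
  · simpa [gammaAct, mul_assoc] using orbitArgmin_minimal h g (γ' * γ)

variable [MeasurableSpace G] [DiscreteMeasurableSpace G]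

lemma measurable_comp_orbitArgmin (f : Γ → ℝ) (g : G) :
    Measurable fun h : Γ → G => f (orbitArgmin h g) := by
  let _ : MeasurableSpace Γ := ⊤
  refine (measurable_from_top (f := f)).comp (measurable_to_countable' fun γ => ?_)
  have : (fun h : Γ → G => orbitArgmin h g) ⁻¹' {γ} =
      ⋂ γ', {h | orbitWeight h g γ ≤ orbitWeight h g γ'} := by
    ext h
    simp [orbitArgmin_eq_iff]
  rw [this]
  refine MeasurableSet.iInter fun γ' => ?_
  have hp : Measurable fun h : Γ → G => (h γ, h γ') :=
    (measurable_pi_apply γ).prodMk (measurable_pi_apply γ')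
  exact hp (.of_discrete (s := {p : G × G |
    toLex ((nonempty_embedding_nat G).some (p.1 * g), (nonempty_embedding_nat Γ).some γ) ≤
    toLex ((nonempty_embedding_nat G).some (p.2 * g), (nonempty_embedding_nat Γ).some γ')}))

end ArgMin

lemma measurable_gammaAct {Γ G : Type*} [Group Γ] [Group G] [Countable G] [MeasurableSpace G]
    [DiscreteMeasurableSpace G] (γ : Γ) : Measurable (gammaAct γ : (Γ → G) → Γ → G) :=
  measurable_pi_lambda _ fun t =>
    (Measurable.of_discrete (f := fun p : G × G => p.1 * p.2⁻¹)).comp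
      (g := fun p : G × G => p.1 * p.2⁻¹) (f := fun h : Γ → G => (h (t * γ), h γ))
      ((measurable_pi_apply (t * γ)).prodMk (measurable_pi_apply γ))

/-- If `Γ` randomly embeds in `G` and `G` is amenable, then `Γ` is amenable. -/
theorem statement13 (Γ G : Type*) [Group Γ] [Group G] [Countable Γ] [Countable G]
    [MeasurableSpace G] [DiscreteMeasurableSpace G]
    (hre : RandomlyEmbeds Γ G) (hG : IsAmenable G) : IsAmenable Γ := by
  obtain ⟨P, hP, hemb, hPinv⟩ := hre
  obtain ⟨m, hadd, hsmul, hnonneg, hone, hinv⟩ := hG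
  have hm : IsMean m := ⟨hadd, hsmul, hnonneg, hone⟩
  have hmeas (f : Γ → ℝ) (g : G) : Measurable fun h : Γ → G => f (orbitArgmin h g)⁻¹ :=
    measurable_comp_orbitArgmin (fun γ => f γ⁻¹) g
  refine ⟨fun f => m fun g => ∫ h, f (orbitArgmin h g)⁻¹ ∂P, ?_, ?_, ?_, ?_, ?_⟩
  · rintro f₁ f₂ ⟨C₁, h₁⟩ ⟨C₂, h₂⟩
    rw [← hm.add _ _ ⟨C₁, fun g => abs_integral_le_bound fun h => h₁ _⟩
      ⟨C₂, fun g => abs_integral_le_bound fun h => h₂ _⟩]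
    refine congrArg m (funext fun g => ?_)
    exact integral_add (integrable_of_abs_le (hmeas f₁ g) fun h => h₁ _)
      (integrable_of_abs_le (hmeas f₂ g) fun h => h₂ _)
  · rintro c f ⟨C, hC⟩
    rw [← hm.smul c _ ⟨C, fun g => abs_integral_le_bound fun h => hC _⟩]
    refine congrArg m (funext fun g => ?_)
    exact integral_const_mul c _
  · rintro f ⟨C, hC⟩ hf
    exact hm.nonneg _ ⟨C, fun g => abs_integral_le_bound fun h => hC _⟩
      fun g => integral_nonneg fun h => hf _
  · rw [← hm.one]
    refine congrArg m (funext fun g => ?_)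
    simp
  · rintro γ f ⟨C, hC⟩
    have hinj : ∀ᵐ h ∂P, h ∈ embSet Γ G := hemb
    calc (m fun g => ∫ h, f (γ⁻¹ * (orbitArgmin h g)⁻¹) ∂P)
        = m fun g => ∫ h, f (orbitArgmin (gammaAct γ⁻¹ h) (h γ⁻¹ * g))⁻¹ ∂P := by
          congr 1
          funext g
          refine integral_congr_ae ?_
          filter_upwards [hinj] with h hh
          rw [orbitArgmin_gammaAct hh.1, inv_inv, mul_inv_rev]
      _ = m fun g => ∫ h, f (orbitArgmin (gammaAct γ⁻¹ h) g)⁻¹ ∂P :=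
          hm.integral_random_translate hinv (measurable_pi_apply γ⁻¹)
            (F := fun h g => f (orbitArgmin (gammaAct γ⁻¹ h) g)⁻¹)
            (fun g => (hmeas f g).comp (measurable_gammaAct γ⁻¹)) (fun h g => hC _)
      _ = m fun g => ∫ h, f (orbitArgmin h g)⁻¹ ∂P := by
          congr 1
          funext g
          conv_rhs => rw [← hPinv γ⁻¹]
          exact (integral_map (measurable_gammaAct γ⁻¹).aemeasurable
            (hmeas f g).aestronglyMeasurable).symm
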